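/- In ℂ[σ₁₁,σ₁₂,σ₁₃,σ₂₂,σ₂₃,σ₃₃], let I = ⟨σ₁₂σ₁₃ − σ₁₁σ₂₃, σ₁₂² − σ₁₁σ₂₂ − σ₁₃² + σ₁₁σ₃₃⟩. Under the invertible linear change of variables σ₁₁ ↦ s₃₃, σ₁₂ ↦ −i s₁₂ + i s₂₂, σ₁₃ ↦ s₁₂ + s₂₂, σ₂₂ ↦ s₂₃, σ₂₃ ↦ s₁₁ + s₁₃, σ₃₃ ↦ 2i s₁₁ − 2i s₁₃ + s₂₃, the image of I in ℂ[s₁₁,s₁₂,s₁₃,s₂₂,s₂₃,s₃₃] equals the ideal ⟨ i s₁₂² + s₁₁s₃₃, i s₂₂² − s₁₃s₃₃ ⟩; in particular, I is generated by binomials after an invertible linear change of variables, i.e., I has toric structure. -/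

import Mathlib

noncomputable section
open MvPolynomial


/-- The linear change of variables `σ₁₁ ↦ s₃₃`, `σ₁₂ ↦ -i s₁₂ + i s₂₂`, `σ₁₃ ↦ s₁₂ + s₂₂`,
`σ₂₂ ↦ s₂₃`, `σ₂₃ ↦ s₁₁ + s₁₃`, `σ₃₃ ↦ 2i s₁₁ - 2i s₁₃ + s₂₃`, where the six variables
`σ₁₁,σ₁₂,σ₁₃,σ₂₂,σ₂₃,σ₃₃` (resp. `s₁₁,s₁₂,s₁₃,s₂₂,s₂₃,s₃₃`) are `X 0,…,X 5`. -/
def chgVar : Fin 6 → MvPolynomial (Fin 6) ℂ :=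
  ![X 5,
    C (-Complex.I) * X 1 + C Complex.I * X 3,
    X 1 + X 3,
    X 4,
    X 0 + X 2,
    C (2 * Complex.I) * X 0 - C (2 * Complex.I) * X 2 + X 4]

lemma hJ : (C Complex.I : MvPolynomial (Fin 6) ℂ) * C Complex.I = -1 := by
  rw [← C_mul, Complex.I_mul_I]; simp

lemma hH : (C (1/2) : MvPolynomial (Fin 6) ℂ) * 2 = 1 := by
  rw [show (2 : MvPolynomial (Fin 6) ℂ) = C 2 from (map_ofNat C 2).symm, ← C_mul]; norm_num

lemma hC2 : (C (2 * Complex.I) : MvPolynomial (Fin 6) ℂ) = 2 * C Complex.I := by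
  rw [C_mul, map_ofNat C 2]

/-- The inverse substitution. -/
def invVar : Fin 6 → MvPolynomial (Fin 6) ℂ :=
  ![C (1/2) * X 4 - C Complex.I * (C (1/2) * C (1/2)) * (X 5 - X 3),
    C (1/2) * (X 2 + C Complex.I * X 1),
    C (1/2) * X 4 + C Complex.I * (C (1/2) * C (1/2)) * (X 5 - X 3),
    C (1/2) * (X 2 - C Complex.I * X 1),
    X 3,
    X 0]

lemma aeval_C' (f : Fin 6 → MvPolynomial (Fin 6) ℂ) (c : ℂ) :
    aeval f (C c : MvPolynomial (Fin 6) ℂ) = C c := by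
  rw [aeval_C]; rfl

set_option maxHeartbeats 2000000 in
/-- With `I = ⟨σ₁₂σ₁₃ − σ₁₁σ₂₃, σ₁₂² − σ₁₁σ₂₂ − σ₁₃² + σ₁₁σ₃₃⟩`, the linear
change of variables `chgVar` is invertible (a bijective ℂ-algebra substitution) and it maps `I`
to the binomial ideal `⟨i s₁₂² + s₁₁s₃₃, i s₂₂² − s₁₃s₃₃⟩`; in particular `I` is generated by
binomials after an invertible linear change of variables, i.e. it has toric structure. -/
theorem coloredGaussian_toric_structure :
    Function.Bijective (aeval chgVar : MvPolynomial (Fin 6) ℂ →ₐ[ℂ] MvPolynomial (Fin 6) ℂ) ∧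
    Ideal.map (aeval chgVar : MvPolynomial (Fin 6) ℂ →ₐ[ℂ] MvPolynomial (Fin 6) ℂ)
        (Ideal.span {(X 1 * X 2 - X 0 * X 4 : MvPolynomial (Fin 6) ℂ),
          X 1 ^ 2 - X 0 * X 3 - X 2 ^ 2 + X 0 * X 5}) =
      Ideal.span {(C Complex.I * X 1 ^ 2 + X 0 * X 5 : MvPolynomial (Fin 6) ℂ),
        C Complex.I * X 3 ^ 2 - X 2 * X 5} := by
  have J := hJ
  have H := hH
  have c0 : chgVar 0 = X 5 := rfl
  have c1 : chgVar 1 = -C Complex.I * X 1 + C Complex.I * X 3 := by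
    rw [← C_neg]; rfl
  have c2 : chgVar 2 = X 1 + X 3 := rfl
  have c3 : chgVar 3 = X 4 := rfl
  have c4 : chgVar 4 = X 0 + X 2 := rfl
  have c5 : chgVar 5 = 2 * C Complex.I * X 0 - 2 * C Complex.I * X 2 + X 4 := by
    rw [← hC2]; rfl
  have d0 : invVar 0 = C (1/2) * X 4 - C Complex.I * (C (1/2) * C (1/2)) * (X 5 - X 3) := rfl
  have d1 : invVar 1 = C (1/2) * (X 2 + C Complex.I * X 1) := rfl
  have d2 : invVar 2 = C (1/2) * X 4 + C Complex.I * (C (1/2) * C (1/2)) * (X 5 - X 3) := rfl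
  have d3 : invVar 3 = C (1/2) * (X 2 - C Complex.I * X 1) := rfl
  have d4 : invVar 4 = X 3 := rfl
  have d5 : invVar 5 = X 0 := rfl
  have h1 : (aeval chgVar : MvPolynomial (Fin 6) ℂ →ₐ[ℂ] MvPolynomial (Fin 6) ℂ).comp
      (aeval invVar) = AlgHom.id ℂ _ := by
    apply algHom_ext
    intro i
    fin_cases i <;>
    simp only [AlgHom.comp_apply, AlgHom.id_apply, aeval_X, Fin.zero_eta, Fin.mk_one,
      Fin.reduceFinMk, c0, c1, c2, c3, c4, c5, d0, d1, d2, d3, d4, d5, map_add, map_sub, map_mul,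
      aeval_C'] <;>
    generalize (C (1/2) : MvPolynomial (Fin 6) ℂ) = h at * <;>
    generalize (C Complex.I : MvPolynomial (Fin 6) ℂ) = j at *
    · linear_combination (-(h * h * 2) * (X 0 - X 2)) * J + (h * X 0 - h * X 2 + X 0) * H
    · linear_combination (h * (X 3 - X 1)) * J + X 1 * H
    · linear_combination ((h * h * 2) * (X 0 - X 2)) * J + (-h * X 0 + h * X 2 + X 2) * H
    · linear_combination (-h * (X 3 - X 1)) * J + X 3 * H
  have h2 : (aeval invVar : MvPolynomial (Fin 6) ℂ →ₐ[ℂ] MvPolynomial (Fin 6) ℂ).comp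
      (aeval chgVar) = AlgHom.id ℂ _ := by
    apply algHom_ext
    intro i
    fin_cases i <;>
    simp only [AlgHom.comp_apply, AlgHom.id_apply, aeval_X, Fin.zero_eta, Fin.mk_one,
      Fin.reduceFinMk, c0, c1, c2, c3, c4, c5, d0, d1, d2, d3, d4, d5, map_add, map_sub, map_mul,
      map_neg, map_ofNat, aeval_C'] <;>
    generalize (C (1/2) : MvPolynomial (Fin 6) ℂ) = h at * <;>
    generalize (C Complex.I : MvPolynomial (Fin 6) ℂ) = j at *
    · linear_combination (-2 * h * X 1) * J + X 1 * H
    · linear_combination X 2 * H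
    · linear_combination X 4 * H
    · linear_combination (-4 * h * h * (X 5 - X 3)) * J + ((2 * h + 1) * (X 5 - X 3)) * H
  refine ⟨⟨?_, ?_⟩, ?_⟩
  · exact Function.LeftInverse.injective (g := aeval (R := ℂ) invVar)
      fun x => by rw [← AlgHom.comp_apply, h2, AlgHom.id_apply]
  · exact Function.RightInverse.surjective (g := aeval (R := ℂ) invVar)
      fun x => by rw [← AlgHom.comp_apply, h1, AlgHom.id_apply]
  · rw [Ideal.map_span, Set.image_pair]
    simp only [aeval_X, c0, c1, c2, c3, c4, c5, map_add, map_sub, map_mul, map_pow]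
    generalize (C (1/2) : MvPolynomial (Fin 6) ℂ) = h at *
    generalize (C Complex.I : MvPolynomial (Fin 6) ℂ) = j at *
    apply le_antisymm <;> rw [Ideal.span_le] <;> rintro x (rfl | rfl) <;>
      rw [SetLike.mem_coe, Ideal.mem_span_pair]
    · exact ⟨-1, 1, by ring⟩
    · exact ⟨2 * j, 2 * j, by linear_combination (X 1 + X 3) ^ 2 * J⟩
    · refine ⟨-h, -j * h * h, ?_⟩
      linear_combination (j * h * h * (X 1 + X 3) ^ 2
        - 2 * h * h * ((j * X 1 ^ 2 + X 0 * X 5) + (j * X 3 ^ 2 - X 2 * X 5))) * J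
        + (h * ((j * X 1 ^ 2 + X 0 * X 5) + (j * X 3 ^ 2 - X 2 * X 5)) + (j * X 1 ^ 2 + X 0 * X 5)) * H
    · refine ⟨h, -j * h * h, ?_⟩
      linear_combination (j * h * h * (X 1 + X 3) ^ 2
        - 2 * h * h * ((j * X 1 ^ 2 + X 0 * X 5) + (j * X 3 ^ 2 - X 2 * X 5))) * J
        + (h * ((j * X 1 ^ 2 + X 0 * X 5) + (j * X 3 ^ 2 - X 2 * X 5)) + (j * X 3 ^ 2 - X 2 * X 5)) * H
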